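/- Let k ≥ 4 be an integer. If G is a finite connected k-chordal graph, then γ_b(G) ≤ ⌊(3/2)·MP(G) + ⌊k/2⌋⌋, where γ_b(G) is the broadcast domination number and MP(G) is the multipacking number of G. -/

import Mathlib

open SimpleGraph

variable {V : Type*}

/-- The diameter of a graph: the supremum of distances between pairs of vertices. -/
noncomputable def gDiam (G : SimpleGraph V) : ℕ :=
  sSup (Set.range fun p : V × V => G.dist p.1 p.2)

/-- A multipacking of a graph `G` is a set `M` of vertices such that for every vertex `v`
and every integer `r ≥ 1`, the ball of radius `r` around `v` contains at most `r`
vertices of `M`. -/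
def IsMultipacking (G : SimpleGraph V) (M : Set V) : Prop :=
  ∀ v : V, ∀ r : ℕ, 1 ≤ r → (M ∩ {u | G.dist u v ≤ r}).ncard ≤ r

/-- The multipacking number of `G`: the maximum size of a multipacking. -/
noncomputable def multipackingNumber (G : SimpleGraph V) : ℕ :=
  sSup {n | ∃ M : Set V, IsMultipacking G M ∧ M.ncard = n}

/-- A dominating broadcast: a function `f : V → ℕ` bounded above by the diameter,
such that every vertex `u` is within distance `f v` of some vertex `v` with `f v > 0`. -/
def IsDominatingBroadcast (G : SimpleGraph V) (f : V → ℕ) : Prop :=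
  (∀ v : V, f v ≤ gDiam G) ∧ ∀ u : V, ∃ v : V, 0 < f v ∧ G.dist u v ≤ f v

/-- The broadcast domination number of `G`: the minimum cost of a dominating broadcast. -/
noncomputable def broadcastDominationNumber (G : SimpleGraph V) : ℕ :=
  sInf {c | ∃ f : V → ℕ, IsDominatingBroadcast G f ∧ ∑ᶠ v : V, f v = c}

/-- A graph is k-chordal if it contains no induced cycle of length greater than k. -/
def IsKChordal (G : SimpleGraph V) (k : ℕ) : Prop :=
  ∀ n : ℕ, k < n → ¬∃ f : Fin n ↪ V, ∀ a b : Fin n,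
    G.Adj (f a) (f b) ↔ (SimpleGraph.cycleGraph n).Adj a b

lemma exists_geodesic {V : Type*} {G : SimpleGraph V} (hconn : G.Connected) (u v : V) :
    ∃ g : ℕ → V, g 0 = u ∧ g (G.dist u v) = v ∧
      (∀ i < G.dist u v, G.Adj (g i) (g (i + 1))) ∧
      ∀ i j, i ≤ j → j ≤ G.dist u v → G.dist (g i) (g j) = j - i := by
  obtain ⟨p, hp⟩ := hconn.exists_walk_length_eq_dist u v
  have hadj : ∀ i < G.dist u v, G.Adj (p.getVert i) (p.getVert (i + 1)) :=
    fun i hi => p.adj_getVert_succ (hp ▸ hi)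
  have hle : ∀ i d, i + d ≤ G.dist u v → G.dist (p.getVert i) (p.getVert (i + d)) ≤ d := by
    intro i d
    induction d with
    | zero => simp
    | succ d ih =>
      intro hd
      have h1 := ih (by omega)
      have h2 := hconn.dist_triangle (u := p.getVert i) (v := p.getVert (i + d))
        (w := p.getVert (i + (d + 1)))
      have h3 := dist_eq_one_iff_adj.2 (hadj (i + d) (by omega))
      rw [add_assoc] at h3
      omega
  refine ⟨p.getVert, p.getVert_zero, by rw [← hp, p.getVert_length], hadj, ?_⟩
  intro i j hij hj
  have h1 := hle 0 i (by omega)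
  have h2 := hle i (j - i) (by omega)
  have h3 := hle j (G.dist u v - j) (by omega)
  rw [zero_add, p.getVert_zero] at h1
  rw [Nat.add_sub_cancel' hij] at h2
  rw [Nat.add_sub_cancel' hj, ← hp, p.getVert_length, hp] at h3
  have h4 := hconn.dist_triangle (u := u) (v := p.getVert i) (w := v)
  have h5 := hconn.dist_triangle (u := p.getVert i) (v := p.getVert j) (w := v)
  omega

lemma dist_le_gDiam {V : Type*} [Finite V] (G : SimpleGraph V) (u v : V) :
    G.dist u v ≤ gDiam G :=
  le_csSup (Set.finite_range _).bddAbove ⟨(u, v), rfl⟩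

lemma exists_dist_eq_gDiam {V : Type*} [Finite V] [Nonempty V] (G : SimpleGraph V) :
    ∃ u v, G.dist u v = gDiam G := by
  obtain ⟨p, hp⟩ := Nat.sSup_mem (Set.range_nonempty fun p : V × V => G.dist p.1 p.2)
    (Set.finite_range _).bddAbove
  exact ⟨p.1, p.2, hp⟩

/-- Every third vertex of a geodesic belongs to a multipacking. -/
lemma dist_div_three_add_one_le_multipackingNumber {V : Type*} [Finite V] {G : SimpleGraph V}
    (hconn : G.Connected) (u v : V) : G.dist u v / 3 + 1 ≤ multipackingNumber G := by
  obtain ⟨g, -, -, -, hg⟩ := exists_geodesic hconn u v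
  have hdist : ∀ i j, i ≤ j → j ≤ G.dist u v / 3 →
      G.dist (g (3 * i)) (g (3 * j)) = 3 * j - 3 * i :=
    fun i j hij hj => hg _ _ (by omega) (by omega)
  refine le_csSup ⟨Nat.card V, ?_⟩
    ⟨(fun i => g (3 * i)) '' (Finset.range (G.dist u v / 3 + 1) : Set ℕ), ?_, ?_⟩
  · rintro _ ⟨M, -, rfl⟩
    exact Set.ncard_le_card M
  · intro z r hr
    let I := (Finset.range (G.dist u v / 3 + 1)).filter fun i => G.dist (g (3 * i)) z ≤ r
    have hsub : (fun i => g (3 * i)) '' (Finset.range (G.dist u v / 3 + 1) : Set ℕ) ∩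
        {y | G.dist y z ≤ r} ⊆ (fun i => g (3 * i)) '' (I : Set ℕ) := by
      rintro _ ⟨⟨i, hi, rfl⟩, hz⟩
      exact ⟨i, by simpa [I] using ⟨by simpa using hi, hz⟩, rfl⟩
    refine (Set.ncard_le_ncard hsub (Set.toFinite _)).trans
      ((Set.ncard_image_le I.finite_toSet).trans ?_)
    rw [Set.ncard_coe_finset]
    rcases I.eq_empty_or_nonempty with h | h
    · simp [h]
    · have hmin := I.min'_mem h
      have hI : I ⊆ Finset.Icc (I.min' h) (I.min' h + 2 * r / 3) := by
        intro i hi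
        have hle := I.min'_le i hi
        simp only [I, Finset.mem_filter, Finset.mem_range] at hi
        have hm := (Finset.mem_filter.1 hmin).2
        have h1 := hdist _ i hle (by omega)
        have h2 := hconn.dist_triangle (u := g (3 * I.min' h)) (v := z) (w := g (3 * i))
        rw [SimpleGraph.dist_comm (u := z)] at h2
        rw [Finset.mem_Icc]
        omega
      have := Finset.card_le_card hI
      rw [Nat.card_Icc] at this
      omega
  · rw [Set.InjOn.ncard_image, Set.ncard_coe_finset, Finset.card_range]
    intro i hi j hj hij
    simp only [Finset.coe_range, Set.mem_Iio] at hi hj hij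
    rcases le_total i j with h | h
    · have := hdist i j h (by omega)
      rw [hij, SimpleGraph.dist_self] at this
      omega
    · have := hdist j i h (by omega)
      rw [hij, SimpleGraph.dist_self] at this
      omega

lemma cycleGraph_adj_iff_val {n : ℕ} (hn : 2 ≤ n) (a b : Fin n) :
    (cycleGraph n).Adj a b ↔ a.val + 1 = b.val ∨ b.val + 1 = a.val ∨
      (a.val = 0 ∧ b.val + 1 = n) ∨ (b.val = 0 ∧ a.val + 1 = n) := by
  have ha := a.2
  have hb := b.2
  rw [cycleGraph_adj', Fin.val_sub, Fin.val_sub]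
  rcases lt_trichotomy a.val b.val with h | h | h
  · rw [Nat.mod_eq_of_lt (by omega : n - b.val + a.val < n),
      (by omega : n - a.val + b.val = (b.val - a.val) + n), Nat.add_mod_right,
      Nat.mod_eq_of_lt (by omega)]
    omega
  · rw [h, Nat.sub_add_cancel hb.le, Nat.mod_self]
    omega
  · rw [Nat.mod_eq_of_lt (by omega : n - a.val + b.val < n),
      (by omega : n - b.val + a.val = (a.val - b.val) + n), Nat.add_mod_right,
      Nat.mod_eq_of_lt (by omega)]
    omega

/-- Two induced paths joined by exactly two edges, between their corresponding ends, form an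
induced cycle. -/
lemma IsKChordal.add_two_le {V : Type*} {G : SimpleGraph V} {k : ℕ} (hG : IsKChordal G k)
    {a n : ℕ} {s p : ℕ → V} (hs : ∀ i j, i < j → j ≤ a → s i ≠ s j)
    (hp : ∀ i j, i < j → j ≤ n → p i ≠ p j) (hsp : ∀ i j, i ≤ a → j ≤ n → s i ≠ p j)
    (hss : ∀ i j, i < j → j ≤ a → (G.Adj (s i) (s j) ↔ i + 1 = j))
    (hpp : ∀ i j, i < j → j ≤ n → (G.Adj (p i) (p j) ↔ i + 1 = j))
    (hadj : ∀ i j, i ≤ a → j ≤ n →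
      (G.Adj (s i) (p j) ↔ (i = 0 ∧ j = 0) ∨ (i = a ∧ j = n))) :
    a + n + 2 ≤ k := by
  by_contra! hk
  let f : ℕ → V := fun t => if t ≤ a then s t else p (a + n + 1 - t)
  have key : ∀ t t', t < t' → t' < a + n + 2 → f t ≠ f t' ∧
      (G.Adj (f t) (f t') ↔ t + 1 = t' ∨ (t = 0 ∧ t' + 1 = a + n + 2)) := by
    intro t t' htt ht'
    by_cases h1 : t ≤ a
    · by_cases h2 : t' ≤ a
      · simp only [f, h1, h2, if_true]
        refine ⟨hs _ _ htt h2, (hss _ _ htt h2).trans ?_⟩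
        omega
      · simp only [f, h1, h2, if_true, if_false]
        refine ⟨hsp _ _ h1 (by omega), (hadj _ _ h1 (by omega)).trans ?_⟩
        omega
    · have h2 : ¬ t' ≤ a := by omega
      simp only [f, h1, h2, if_false]
      refine ⟨(hp _ _ (by omega) (by omega)).symm, ?_⟩
      rw [G.adj_comm, hpp _ _ (by omega) (by omega)]
      omega
  refine hG _ hk ⟨⟨fun t => f t, ?_⟩, ?_⟩
  · intro t t' h
    rcases lt_trichotomy t.val t'.val with h' | h' | h'
    · exact absurd h (key _ _ h' t'.2).1
    · exact Fin.ext h'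
    · exact absurd h.symm (key _ _ h' t.2).1
  · intro t t'
    rw [cycleGraph_adj_iff_val (by omega)]
    change G.Adj (f t) (f t') ↔ _
    rcases lt_trichotomy t.val t'.val with h | h | h
    · rw [(key _ _ h t'.2).2]
      omega
    · rw [h]
      simp only [G.irrefl, false_iff]
      omega
    · rw [G.adj_comm, (key _ _ h t.2).2]
      omega

/-- Between two sets of vertices, both met by a walk inside `T`, there is an induced path inside
`T` whose interior avoids the two sets. -/
lemma exists_induced_path_between {V : Type*} {G : SimpleGraph V} {T X Y : Set V}
    (hex : ∃ (n : ℕ) (p : ℕ → V), p 0 ∈ X ∧ p n ∈ Y ∧ (∀ i ≤ n, p i ∈ T) ∧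
      ∀ i < n, G.Adj (p i) (p (i + 1))) :
    ∃ (n : ℕ) (p : ℕ → V), p 0 ∈ X ∧ p n ∈ Y ∧ (∀ i ≤ n, p i ∈ T) ∧
      (∀ i ≤ n, p i ∈ X → i = 0) ∧ (∀ i ≤ n, p i ∈ Y → i = n) ∧
      (∀ i j, i < j → j ≤ n → p i ≠ p j) ∧
      ∀ i j, i < j → j ≤ n → (G.Adj (p i) (p j) ↔ i + 1 = j) := by
  classical
  have hmin := fun m (hm : m < Nat.find hex) => Nat.find_min hex hm
  obtain ⟨p, h0, hn, hT, hadj⟩ := Nat.find_spec hex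
  set n := Nat.find hex
  have hX : ∀ i ≤ n, p i ∈ X → i = 0 := by
    intro i hi hiX
    by_contra hne
    refine hmin (n - i) (by omega) ⟨fun t => p (t + i), by simpa, ?_, ?_, ?_⟩
    · simpa [Nat.sub_add_cancel hi] using hn
    · intro t ht
      exact hT _ (by omega)
    · intro t ht
      have := hadj (t + i) (by omega)
      rwa [add_right_comm] at this
  have hY : ∀ i ≤ n, p i ∈ Y → i = n := by
    intro i hi hiY
    by_contra hne
    exact hmin i (by omega) ⟨p, h0, hiY, fun t ht => hT t (by omega),
      fun t ht => hadj t (by omega)⟩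
  have hpp : ∀ i j, i < j → j ≤ n → G.Adj (p i) (p j) → i + 1 = j := by
    intro i j hij hj h
    by_contra hne
    refine hmin (n - (j - i - 1)) (by omega)
      ⟨fun t => if t ≤ i then p t else p (t + (j - i - 1)), by simpa, ?_, ?_, ?_⟩
    · have h1 : ¬ n - (j - i - 1) ≤ i := by omega
      have h2 : n - (j - i - 1) + (j - i - 1) = n := by omega
      simpa only [h1, if_false, h2] using hn
    · intro t ht
      dsimp only
      split_ifs
      · exact hT _ (by omega)
      · exact hT _ (by omega)
    · intro t ht
      rcases lt_trichotomy t i with h' | rfl | h'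
      · simp only [h'.le, Nat.succ_le_of_lt h', if_true]
        exact hadj t (by omega)
      · have h2 : t + 1 + (j - t - 1) = j := by omega
        simpa [h2] using h
      · have h1 : ¬ t ≤ i := by omega
        have h2 : ¬ t + 1 ≤ i := by omega
        have := hadj (t + (j - i - 1)) (by omega)
        rw [add_right_comm] at this
        simpa only [h1, h2, if_false] using this
  refine ⟨n, p, h0, hn, hT, hX, hY, ?_, ?_⟩
  · intro i j hij hj h
    rcases hj.eq_or_lt with rfl | hj'
    · have := hY i hij.le (h ▸ hn)
      omega
    · have h1 := hadj j hj'
      rw [← h] at h1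
      have := hpp i (j + 1) (by omega) (by omega) h1
      omega
  · intro i j hij hj
    refine ⟨hpp i j hij hj, ?_⟩
    rintro rfl
    exact hadj i (by omega)

/-- In a connected `k`-chordal graph, the middle vertex of a diametral geodesic is within distance
`⌈diam / 2⌉ + ⌊k / 2⌋` of every vertex. -/
lemma IsKChordal.exists_dist_le {V : Type*} [Finite V] {G : SimpleGraph V}
    (hconn : G.Connected) {k : ℕ} (hk : 4 ≤ k) (hG : IsKChordal G k) :
    ∃ c, ∀ w, G.dist c w ≤ (gDiam G + 1) / 2 + k / 2 := by
  have := hconn.nonempty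
  obtain ⟨u, v, huv⟩ := exists_dist_eq_gDiam G
  have hdiam := dist_le_gDiam G
  have htri : ∀ a b c, G.dist a c ≤ G.dist a b + G.dist b c :=
    fun a b c => hconn.dist_triangle
  have hcomm : ∀ a b, G.dist a b = G.dist b a := fun a b => SimpleGraph.dist_comm
  obtain ⟨s, hs0, hsD, -, hs⟩ := exists_geodesic hconn u v
  rw [huv] at hsD hs
  set D := gDiam G
  obtain ⟨h, hh⟩ : ∃ h, h = D / 2 := ⟨_, rfl⟩
  refine ⟨s h, fun w => ?_⟩
  by_contra! hR
  have hD := hdiam (s h) w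
  have hus : ∀ i ≤ D, G.dist u (s i) = i := fun i hi => by
    simpa [hs0] using hs 0 i (by omega) hi
  have hvs : ∀ i ≤ D, G.dist v (s i) = D - i := fun i hi => by
    rw [hcomm]; simpa [hsD] using hs i D hi le_rfl
  let U : Set V := {z | G.dist u z + G.dist z w ≤ D}
  let W : Set V := {z | G.dist v z + G.dist z w ≤ D}
  let X : Set V := {z | z ∈ U ∪ W ∧ ∃ i < h, G.dist z (s i) ≤ 1}
  let Y : Set V := {z | z ∈ U ∪ W ∧ ∃ i, h < i ∧ i ≤ D ∧ G.dist z (s i) ≤ 1}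
  have hc : ∀ z ∈ U ∪ W, 2 ≤ G.dist z (s h) := by
    rintro z (hz | hz)
    · have h1 := htri u z (s h)
      have h2 := htri (s h) z w
      have h3 := hus h (by omega)
      have h4 := hcomm z (s h)
      change _ ≤ D at hz
      omega
    · have h1 := htri v z (s h)
      have h2 := htri (s h) z w
      have h3 := hvs h (by omega)
      have h4 := hcomm z (s h)
      change _ ≤ D at hz
      omega
  have hXW : ∀ z ∈ X, z ∉ W := by
    rintro z ⟨-, i, hi, hzi⟩ hz
    change _ ≤ D at hz
    have h1 := htri v z (s i)
    have h2 := hvs i (by omega)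
    have h3 := htri (s h) (s i) w
    have h4 := htri (s i) z w
    have h5 := hs i h hi.le (by omega)
    have h6 := hcomm (s i) (s h)
    have h7 := hcomm (s i) z
    omega
  have hYU : ∀ z ∈ Y, z ∉ U := by
    rintro z ⟨-, i, hi, hiD, hzi⟩ hz
    change _ ≤ D at hz
    have h1 := htri u z (s i)
    have h2 := hus i (by omega)
    have h3 := htri (s h) (s i) w
    have h4 := htri (s i) z w
    have h5 := hs h i hi.le (by omega)
    have h7 := hcomm (s i) z
    omega
  obtain ⟨n, p, hp0, hpn, hpT, hpX, hpY, hpne, hpadj⟩ :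
      ∃ (n : ℕ) (p : ℕ → V), p 0 ∈ X ∧ p n ∈ Y ∧ (∀ i ≤ n, p i ∈ U ∪ W) ∧
      (∀ i ≤ n, p i ∈ X → i = 0) ∧ (∀ i ≤ n, p i ∈ Y → i = n) ∧
      (∀ i j, i < j → j ≤ n → p i ≠ p j) ∧
      ∀ i j, i < j → j ≤ n → (G.Adj (p i) (p j) ↔ i + 1 = j) := by
    apply exists_induced_path_between
    obtain ⟨g, hg0, hg1, hgadj, hg⟩ := exists_geodesic hconn u w
    obtain ⟨g', hg0', hg1', hgadj', hg'⟩ := exists_geodesic hconn w v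
    have huw := hdiam u w
    have hwv := hdiam w v
    have hgU : ∀ i ≤ G.dist u w, g i ∈ U := by
      intro i hi
      have h1 := hg 0 i (by omega) hi
      have h2 := hg i _ hi le_rfl
      rw [hg0] at h1
      rw [hg1] at h2
      change _ ≤ D
      omega
    have hgW : ∀ i ≤ G.dist w v, g' i ∈ W := by
      intro i hi
      have h1 := hg' 0 i (by omega) hi
      have h2 := hg' i _ hi le_rfl
      rw [hg0'] at h1
      rw [hg1'] at h2
      have h3 := hcomm v (g' i)
      have h4 := hcomm w (g' i)
      change _ ≤ D
      omega
    have hval : ∀ t, (if G.dist u w + t ≤ G.dist u w then g (G.dist u w + t)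
        else g' (G.dist u w + t - G.dist u w)) = g' t := by
      intro t
      rcases Nat.eq_zero_or_pos t with rfl | ht
      · simp [hg1, hg0']
      · rw [if_neg (by omega), Nat.add_sub_cancel_left]
    have hT : ∀ i ≤ G.dist u w + G.dist w v,
        (if i ≤ G.dist u w then g i else g' (i - G.dist u w)) ∈ U ∪ W := by
      intro i hi
      split_ifs with h1
      · exact Or.inl (hgU i h1)
      · exact Or.inr (hgW _ (by omega))
    refine ⟨G.dist u w + G.dist w v,
      fun t => if t ≤ G.dist u w then g t else g' (t - G.dist u w), ?_, ?_, hT, ?_⟩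
    · refine ⟨hT 0 (by omega), 0, by omega, ?_⟩
      simp [hg0, hs0]
    · refine ⟨hT _ le_rfl, D, by omega, le_rfl, ?_⟩
      dsimp only
      rw [hval, hg1', hsD, SimpleGraph.dist_self]
      omega
    · intro i hi
      rcases lt_or_ge i (G.dist u w) with h1 | h1
      · simp only [h1.le, Nat.succ_le_of_lt h1, if_true]
        exact hgadj i h1
      · obtain ⟨t, rfl⟩ := Nat.exists_eq_add_of_le h1
        dsimp only
        rw [add_assoc, hval, hval]
        exact hgadj' t (by omega)
  obtain ⟨i, ⟨hih, hi1⟩, himax⟩ : ∃ i, (i < h ∧ G.dist (p 0) (s i) ≤ 1) ∧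
      ∀ j, i < j → j ≤ h → 2 ≤ G.dist (p 0) (s j) := by
    classical
    obtain ⟨-, i₀, hi₀, hi₀'⟩ := hp0
    have hspec := Nat.findGreatest_spec
      (P := fun i => i < h ∧ G.dist (p 0) (s i) ≤ 1) hi₀.le ⟨hi₀, hi₀'⟩
    refine ⟨_, hspec, fun j hj hjh => ?_⟩
    rcases hjh.eq_or_lt with rfl | hjh'
    · exact hc _ (hpT 0 (by omega))
    · have := Nat.findGreatest_is_greatest hj hjh
      by_contra!
      exact Nat.findGreatest_is_greatest hj hjh ⟨hjh', by omega⟩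
  obtain ⟨j, ⟨hhj, hjD, hj1⟩, hjmin⟩ :
      ∃ j, (h < j ∧ j ≤ D ∧ G.dist (p n) (s j) ≤ 1) ∧
      ∀ l, h ≤ l → l < j → 2 ≤ G.dist (p n) (s l) := by
    classical
    obtain ⟨-, hex⟩ := hpn
    refine ⟨_, Nat.find_spec hex, fun l hhl hl => ?_⟩
    have hjD := (Nat.find_spec hex).2.1
    rcases hhl.eq_or_lt with rfl | hhl'
    · exact hc _ (hpT n le_rfl)
    · by_contra!
      exact Nat.find_min hex hl ⟨hhl', by omega, by omega⟩
  have hn : 0 < n := by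
    rcases Nat.eq_zero_or_pos n with rfl | h'
    · exact absurd (hpT 0 le_rfl) (not_or.2 ⟨hYU _ hpn, hXW _ hp0⟩)
    · exact h'
  have hfar : ∀ l m, i ≤ l → l ≤ j → m ≤ n → ¬ (l = i ∧ m = 0) → ¬ (l = j ∧ m = n) →
      2 ≤ G.dist (p m) (s l) := by
    intro l m hil hlj hm h1 h2
    by_contra! hlt
    rcases lt_trichotomy l h with hl | hl | hl
    · obtain rfl := hpX m hm ⟨hpT m hm, l, hl, by omega⟩
      have := himax l (by omega) hl.le
      omega
    · have := hc _ (hpT m hm)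
      rw [hl] at hlt
      omega
    · obtain rfl := hpY m hm ⟨hpT m hm, l, hl, by omega, by omega⟩
      have := hjmin l hl.le (by omega)
      omega
  have hi0 : G.dist (p 0) (s i) = 1 := by
    have h1 := hfar (i + 1) 0 (by omega) (by omega) (by omega) (by omega) (by omega)
    have h2 := htri (p 0) (s i) (s (i + 1))
    have h3 := hs i (i + 1) (by omega) (by omega)
    omega
  have hj0 : G.dist (p n) (s j) = 1 := by
    have h1 := hfar (j - 1) n (by omega) (by omega) (by omega) (by omega) (by omega)
    have h2 := htri (p n) (s j) (s (j - 1))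
    have h3 := hs (j - 1) j (by omega) (by omega)
    have h4 := hcomm (s j) (s (j - 1))
    omega
  have hcycle := hG.add_two_le (a := j - i) (n := n) (s := fun t => s (i + t)) (p := p)
    (fun a b hab hb heq => by
      have := hs (i + a) (i + b) (by omega) (by omega)
      rw [heq, SimpleGraph.dist_self] at this
      omega)
    hpne
    (fun a b ha hb heq => by
      have hd : G.dist (p b) (s (i + a)) = 0 := by rw [heq, SimpleGraph.dist_self]
      by_cases h1 : i + a = i ∧ b = 0
      · rw [h1.1, h1.2] at hd
        omega
      by_cases h2 : i + a = j ∧ b = n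
      · rw [h2.1, h2.2] at hd
        omega
      have := hfar (i + a) b (by omega) (by omega) hb h1 h2
      omega)
    (fun a b hab hb => by
      rw [← dist_eq_one_iff_adj, hs (i + a) (i + b) (by omega) (by omega)]
      omega)
    hpadj
    (fun a b ha hb => by
      rw [← dist_eq_one_iff_adj, hcomm]
      constructor
      · intro hd
        by_contra hne
        have := hfar (i + a) b (by omega) (by omega) hb (by omega) (by omega)
        omega
      · rintro (⟨rfl, rfl⟩ | ⟨rfl, rfl⟩)
        · exact hi0
        · rwa [Nat.add_sub_cancel' (by omega)])
  have hlen : ∀ l ≤ n, G.dist (p 0) (p l) ≤ l := by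
    intro l
    induction l with
    | zero => simp
    | succ l ih =>
      intro hl
      have h1 := ih (by omega)
      have h2 := htri (p 0) (p l) (p (l + 1))
      have h3 := dist_eq_one_iff_adj.2 ((hpadj l (l + 1) (by omega) hl).2 rfl)
      omega
  have hxU : G.dist u (p 0) + G.dist (p 0) w ≤ D :=
    (hpT 0 (by omega)).resolve_right (hXW _ hp0)
  have hyW : G.dist v (p n) + G.dist (p n) w ≤ D :=
    (hpT n le_rfl).resolve_left (hYU _ hpn)
  have h1 := hlen n le_rfl
  have h2 := htri u (p 0) v
  have h3 := htri (p 0) (p n) v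
  have h4 := htri (s h) (s i) w
  have h5 := htri (s i) (p 0) w
  have h6 := htri (s h) (s j) w
  have h7 := htri (s j) (p n) w
  have h8 := hs i h hih.le (by omega)
  have h9 := hs h j hhj.le (by omega)
  have h10 := hcomm (s h) (s i)
  have h11 := hcomm (s i) (p 0)
  have h12 := hcomm (s j) (p n)
  have h13 := hcomm (p n) v
  omega

lemma broadcastDominationNumber_le_of_dist_le {V : Type*} [Finite V] {G : SimpleGraph V}
    {c : V} {r : ℕ} (hr0 : 0 < r) (hr : ∀ w, G.dist c w ≤ r) :
    broadcastDominationNumber G ≤ r := by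
  classical
  rcases Nat.eq_zero_or_pos (gDiam G) with h0 | hpos
  · have hempty : {b | ∃ f : V → ℕ, IsDominatingBroadcast G f ∧ ∑ᶠ v : V, f v = b} = ∅ := by
      rw [Set.eq_empty_iff_forall_notMem]
      rintro _ ⟨f, ⟨hf, hdom⟩, -⟩
      obtain ⟨v, hv, -⟩ := hdom c
      have := hf v
      omega
    rw [broadcastDominationNumber, hempty, Nat.sInf_empty]
    omega
  · suffices h : IsDominatingBroadcast G (Pi.single c (min (gDiam G) r)) by
      have hle : broadcastDominationNumber G ≤
          ∑ᶠ v : V, (Pi.single c (min (gDiam G) r) : V → ℕ) v :=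
        Nat.sInf_le ⟨_, h, rfl⟩
      refine hle.trans ?_
      rw [finsum_eq_single _ c (fun v hv => by simp [hv])]
      simp
    refine ⟨fun v => ?_, fun w => ?_⟩
    · by_cases hv : v = c
      · subst hv; simp
      · simp [hv]
    · refine ⟨c, by simpa using ⟨hpos, hr0⟩, ?_⟩
      rw [SimpleGraph.dist_comm]
      simpa using ⟨dist_le_gDiam G c w, hr w⟩


/-- If G is a finite connected k-chordal graph with k ≥ 4,
then γ_b(G) ≤ ⌊(3/2)·MP(G) + ⌊k/2⌋⌋. -/
theorem stmt7 {V : Type*} [Fintype V] (G : SimpleGraph V) (hconn : G.Connected)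
    (k : ℕ) (hk : 4 ≤ k) (hkchordal : IsKChordal G k) :
    broadcastDominationNumber G ≤
      ⌊(3 / 2 : ℚ) * multipackingNumber G + (k / 2 : ℕ)⌋₊ := by
  obtain ⟨c, hc⟩ := hkchordal.exists_dist_le hconn hk
  have := hconn.nonempty
  obtain ⟨u, v, huv⟩ := exists_dist_eq_gDiam G
  have hmp := dist_div_three_add_one_le_multipackingNumber hconn u v
  rw [huv] at hmp
  refine (broadcastDominationNumber_le_of_dist_le (by omega) hc).trans (Nat.le_floor ?_)
  have hle : 2 * ((gDiam G + 1) / 2 + k / 2) ≤ 3 * multipackingNumber G + 2 * (k / 2) := by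
    omega
  have hle' : (2 * ((gDiam G + 1) / 2 + k / 2 : ℕ) : ℚ) ≤
      3 * multipackingNumber G + 2 * (k / 2 : ℕ) := by exact_mod_cast hle
  linarith
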